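/- arXiv:1810.04459 — 2 statements merged into one kernel-verified Lean document; each statement's English description precedes it below -/
import Mathlib

section
/- Let {N_i}_{i∈J} be a family of graded ideals of a Lie superalgebra L over a field F (char F ≠ 2,3). If for each i ∈ J the quotient Lie superalgebra L/N_i is capable, then L/⋂_{i∈J} N_i is capable. -/
/-!
Common definitions: Lie superalgebras over a field `F` (char ≠ 2,3 where needed),
graded ideals, centers, capability, epicenter, non-abelian tensor and exterior
products (characterized by generators-and-relations universal properties),
free Lie superalgebras, Schur multipliers, Heisenberg Lie superalgebras, etc.
-/

namespace SuperLie

open Submodule Function Module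

universe u v w

/-- The sign `(-1)^{|a||b|}` attached to a pair of `ℤ₂`-degrees. -/
def sg (F : Type u) [Field F] (a b : ZMod 2) : F := (-1 : F) ^ (a.val * b.val)

/-- A Lie superalgebra over `F`: a `ℤ₂`-graded vector space `L = L₀ ⊕ L₁`
together with an even bilinear bracket satisfying graded skew-symmetry and the
graded Jacobi identity (on homogeneous elements). -/
class LieSuper (F : Type u) [Field F] (L : Type v) [AddCommGroup L] [Module F L] where
  gr : ZMod 2 → Submodule F L
  isCompl_gr : IsCompl (gr 0) (gr 1)
  br : L → L → L
  br_add_left : ∀ x y z : L, br (x + y) z = br x z + br y z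
  br_add_right : ∀ x y z : L, br x (y + z) = br x y + br x z
  br_smul_left : ∀ (c : F) (x y : L), br (c • x) y = c • br x y
  br_smul_right : ∀ (c : F) (x y : L), br x (c • y) = c • br x y
  br_gr : ∀ a b : ZMod 2, ∀ x ∈ gr a, ∀ y ∈ gr b, br x y ∈ gr (a + b)
  br_skew : ∀ a b : ZMod 2, ∀ x ∈ gr a, ∀ y ∈ gr b, br x y = -(sg F a b) • br y x
  br_jacobi : ∀ a b c : ZMod 2, ∀ x ∈ gr a, ∀ y ∈ gr b, ∀ z ∈ gr c,
    sg F a c • br x (br y z) + sg F b a • br y (br z x) + sg F c b • br z (br x y) = 0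

/-- The `a`-graded piece of a Lie superalgebra. -/
def grd (F : Type u) [Field F] (L : Type v) [AddCommGroup L] [Module F L] [LieSuper F L]
    (a : ZMod 2) : Submodule F L :=
  LieSuper.gr a

/-- The bracket of a Lie superalgebra. -/
def sbr (F : Type u) [Field F] {L : Type v} [AddCommGroup L] [Module F L] [LieSuper F L]
    (x y : L) : L :=
  LieSuper.br (F := F) x y

/-- The center `Z(L) = {z ∈ L : [z,x] = 0 for all x ∈ L}`. -/
def centerS (F : Type u) [Field F] (L : Type v) [AddCommGroup L] [Module F L] [LieSuper F L] :
    Submodule F L where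
  carrier := {z : L | ∀ x : L, sbr F z x = 0}
  add_mem' := by
    intro a b ha hb x
    simp only [Set.mem_setOf_eq, sbr] at ha hb ⊢
    rw [LieSuper.br_add_left, ha x, hb x, add_zero]
  zero_mem' := by
    intro x
    have h := LieSuper.br_smul_left (F := F) (0 : F) (0 : L) x
    simp only [Set.mem_setOf_eq, sbr, zero_smul] at h ⊢
    simpa using h
  smul_mem' := by
    intro c a ha x
    simp only [Set.mem_setOf_eq, sbr] at ha ⊢
    rw [LieSuper.br_smul_left, ha x, smul_zero]

/-- Homomorphisms of Lie superalgebras: even (grading preserving) linear maps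
which preserve the bracket. -/
def IsHom (F : Type u) [Field F] {L : Type v} {M : Type w}
    [AddCommGroup L] [Module F L] [LieSuper F L]
    [AddCommGroup M] [Module F M] [LieSuper F M] (f : L →ₗ[F] M) : Prop :=
  (∀ a : ZMod 2, ∀ x ∈ grd F L a, f x ∈ grd F M a) ∧
  (∀ x y : L, f (sbr F x y) = sbr F (f x) (f y))

/-- A bundled Lie superalgebra over `F`. -/
structure LieSupAlg (F : Type u) [Field F] : Type (max u (v + 1)) where
  carrier : Type v
  [iag : AddCommGroup carrier]
  [imo : Module F carrier]
  [ils : LieSuper F carrier]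

attribute [instance] LieSupAlg.iag LieSupAlg.imo LieSupAlg.ils

instance (F : Type u) [Field F] : CoeSort (LieSupAlg.{u, v} F) (Type v) :=
  ⟨LieSupAlg.carrier⟩

/-- A Lie superalgebra `L` is capable if `L ≅ H/Z(H)` for some Lie superalgebra `H`,
i.e. there is a surjective homomorphism onto `L` whose kernel is exactly the center. -/
def Capable (F : Type u) [Field F] (L : Type v) [AddCommGroup L] [Module F L]
    [LieSuper F L] : Prop :=
  ∃ (H : LieSupAlg.{u, max u v} F) (φ : H.carrier →ₗ[F] L),
    IsHom F φ ∧ Surjective φ ∧ LinearMap.ker φ = centerS F H.carrier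

/-- Graded ideals of a Lie superalgebra. -/
def IsGIdeal (F : Type u) [Field F] {L : Type v} [AddCommGroup L] [Module F L]
    [LieSuper F L] (I : Submodule F L) : Prop :=
  (∀ x ∈ I, ∀ y : L, sbr F x y ∈ I) ∧ (∀ y : L, ∀ x ∈ I, sbr F y x ∈ I) ∧
  (∀ x ∈ I, ∃ x0 ∈ I ⊓ grd F L 0, ∃ x1 ∈ I ⊓ grd F L 1, x = x0 + x1)

/-- The graded ideal generated by a subset. -/
def idealClosure (F : Type u) [Field F] {L : Type v} [AddCommGroup L] [Module F L]
    [LieSuper F L] (S : Set L) : Submodule F L :=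
  sInf {I : Submodule F L | IsGIdeal F I ∧ S ⊆ ↑I}

/-- `QuotCapable F L N` expresses that the quotient Lie superalgebra `L/N` is capable. -/
def QuotCapable (F : Type u) [Field F] (L : Type v) [AddCommGroup L] [Module F L]
    [LieSuper F L] (N : Submodule F L) : Prop :=
  ∃ (Q : LieSupAlg.{u, max u v} F) (π : L →ₗ[F] Q.carrier),
    IsHom F π ∧ Surjective π ∧ LinearMap.ker π = N ∧ Capable F Q.carrier

/-- The epicenter `Z^*(L)`: the smallest graded ideal of `L` such that the
corresponding quotient is capable. -/
def IsEpicenter (F : Type u) [Field F] (L : Type v) [AddCommGroup L] [Module F L]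
    [LieSuper F L] (Z : Submodule F L) : Prop :=
  IsGIdeal F Z ∧ QuotCapable F L Z ∧
  ∀ N : Submodule F L, IsGIdeal F N → QuotCapable F L N → Z ≤ N

/-- The submodule `[I,J]` spanned by brackets. -/
def bracketSpan (F : Type u) [Field F] {L : Type v} [AddCommGroup L] [Module F L]
    [LieSuper F L] (I J : Submodule F L) : Submodule F L :=
  Submodule.span F {z : L | ∃ x ∈ I, ∃ y ∈ J, z = sbr F x y}

/-- The derived subalgebra `L' = [L,L]`. -/
def derived (F : Type u) [Field F] (L : Type v) [AddCommGroup L] [Module F L]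
    [LieSuper F L] : Submodule F L :=
  bracketSpan F (⊤ : Submodule F L) ⊤

/-- The lower central series of a Lie superalgebra. -/
def lowerCentral (F : Type u) [Field F] (L : Type v) [AddCommGroup L] [Module F L]
    [LieSuper F L] : ℕ → Submodule F L
  | 0 => ⊤
  | n + 1 => bracketSpan F (lowerCentral F L n) ⊤

/-- A Lie superalgebra is nilpotent if its lower central series terminates at zero. -/
def IsNilp (F : Type u) [Field F] (L : Type v) [AddCommGroup L] [Module F L]
    [LieSuper F L] : Prop :=
  ∃ n : ℕ, lowerCentral F L n = ⊥

/-- An action of a Lie superalgebra `P` on a Lie superalgebra `M`: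
an even bilinear map satisfying the two action axioms. -/
structure IsAction (F : Type u) [Field F] {P : Type v} {M : Type v}
    [AddCommGroup P] [Module F P] [LieSuper F P]
    [AddCommGroup M] [Module F M] [LieSuper F M] (act : P → M → M) : Prop where
  add_left : ∀ (p q : P) (m : M), act (p + q) m = act p m + act q m
  add_right : ∀ (p : P) (m m' : M), act p (m + m') = act p m + act p m'
  smul_left : ∀ (c : F) (p : P) (m : M), act (c • p) m = c • act p m
  smul_right : ∀ (c : F) (p : P) (m : M), act p (c • m) = c • act p m
  grade : ∀ a b : ZMod 2, ∀ p ∈ grd F P a, ∀ m ∈ grd F M b, act p m ∈ grd F M (a + b)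
  br_act : ∀ a b : ZMod 2, ∀ p ∈ grd F P a, ∀ p' ∈ grd F P b, ∀ m : M,
    act (sbr F p p') m = act p (act p' m) - sg F a b • act p' (act p m)
  act_br : ∀ a b : ZMod 2, ∀ p ∈ grd F P a, ∀ m ∈ grd F M b, ∀ m' : M,
    act p (sbr F m m') = sbr F (act p m) m' + sg F a b • sbr F m (act p m')

/-- Compatibility of mutual actions of two Lie superalgebras on each other. -/
def Compatible (F : Type u) [Field F] {M : Type v} {N : Type v}
    [AddCommGroup M] [Module F M] [LieSuper F M]
    [AddCommGroup N] [Module F N] [LieSuper F N]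
    (actMN : M → N → N) (actNM : N → M → M) : Prop :=
  (∀ a b : ZMod 2, ∀ m ∈ grd F M a, ∀ n ∈ grd F N b, ∀ n' : N,
      actMN (actNM n m) n' = -(sg F a b) • sbr F (actMN m n) n') ∧
  (∀ a b : ZMod 2, ∀ m ∈ grd F M a, ∀ n ∈ grd F N b, ∀ m' : M,
      actNM (actMN m n) m' = -(sg F a b) • sbr F (actNM n m) m')

/-- The defining relations of the non-abelian tensor product `M ⊗ N` of Lie
superalgebras (with given mutual actions), satisfied by a pairing `q` into `T`. -/
structure TensorRel (F : Type u) [Field F] {M : Type v} {N : Type v} {T : Type w}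
    [AddCommGroup M] [Module F M] [LieSuper F M]
    [AddCommGroup N] [Module F N] [LieSuper F N]
    [AddCommGroup T] [Module F T] [LieSuper F T]
    (actMN : M → N → N) (actNM : N → M → M) (q : M → N → T) : Prop where
  add_left : ∀ (m m' : M) (n : N), q (m + m') n = q m n + q m' n
  add_right : ∀ (m : M) (n n' : N), q m (n + n') = q m n + q m n'
  smul_left : ∀ (c : F) (m : M) (n : N), q (c • m) n = c • q m n
  smul_right : ∀ (c : F) (m : M) (n : N), q m (c • n) = c • q m n
  grade : ∀ a b : ZMod 2, ∀ m ∈ grd F M a, ∀ n ∈ grd F N b, q m n ∈ grd F T (a + b)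
  brk_left : ∀ a b : ZMod 2, ∀ m ∈ grd F M a, ∀ m' ∈ grd F M b, ∀ n : N,
    q (sbr F m m') n = q m (actMN m' n) - sg F a b • q m' (actMN m n)
  brk_right : ∀ a b c : ZMod 2, ∀ m ∈ grd F M a, ∀ n ∈ grd F N b, ∀ n' ∈ grd F N c,
    q m (sbr F n n') = sg F c (a + b) • q (actNM n' m) n - sg F a b • q (actNM n m) n'
  brk_brk : ∀ a b : ZMod 2, ∀ m ∈ grd F M a, ∀ n ∈ grd F N b, ∀ (m' : M) (n' : N),
    sbr F (q m n) (q m' n') = -(sg F a b) • q (actNM n m) (actMN m' n')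

/-- `IsTensorObj F actMN actNM t` says that `(T, t)` is the non-abelian tensor
product `M ⊗ N`: the pairing `t` satisfies the defining relations and is
universal among all pairings satisfying them. -/
structure IsTensorObj (F : Type u) [Field F] {M : Type v} {N : Type v} {T : Type v}
    [AddCommGroup M] [Module F M] [LieSuper F M]
    [AddCommGroup N] [Module F N] [LieSuper F N]
    [AddCommGroup T] [Module F T] [LieSuper F T]
    (actMN : M → N → N) (actNM : N → M → M) (t : M → N → T) : Prop where
  rel : TensorRel F actMN actNM t
  lift : ∀ (Q : LieSupAlg.{u, max u v} F) (q : M → N → Q.carrier),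
    TensorRel F actMN actNM q →
    ∃! h : T →ₗ[F] Q.carrier, IsHom F h ∧ ∀ (m : M) (n : N), h (t m n) = q m n

/-- The defining relations of the non-abelian exterior square `L ∧ L` of a Lie
superalgebra (the tensor relations for the bracket actions, together with the
graded alternating relations coming from `L □ L`). -/
structure ExtRel (F : Type u) [Field F] {L : Type v} {T : Type w}
    [AddCommGroup L] [Module F L] [LieSuper F L]
    [AddCommGroup T] [Module F T] [LieSuper F T] (q : L → L → T) : Prop where
  toTensor : TensorRel F (fun x y : L => sbr F x y) (fun x y : L => sbr F x y) q
  alt : ∀ a b : ZMod 2, ∀ x ∈ grd F L a, ∀ y ∈ grd F L b, q x y = -(sg F a b) • q y x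
  alt_even : ∀ x ∈ grd F L 0, q x x = 0

/-- `IsExtObj F t` says that `(E, t)` is the non-abelian exterior square `L ∧ L`. -/
structure IsExtObj (F : Type u) [Field F] {L : Type v} {E : Type v}
    [AddCommGroup L] [Module F L] [LieSuper F L]
    [AddCommGroup E] [Module F E] [LieSuper F E] (t : L → L → E) : Prop where
  rel : ExtRel F t
  lift : ∀ (Q : LieSupAlg.{u, max u v} F) (q : L → L → Q.carrier),
    ExtRel F q →
    ∃! h : E →ₗ[F] Q.carrier, IsHom F h ∧ ∀ x y : L, h (t x y) = q x y

/-- A free Lie superalgebra: free on some `ℤ₂`-graded subset `X`. -/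
def IsFreeLieSuper (F : Type u) [Field F] (Fr : Type v) [AddCommGroup Fr] [Module F Fr]
    [LieSuper F Fr] : Prop :=
  ∃ X : ZMod 2 → Set Fr,
    (∀ a : ZMod 2, X a ⊆ (grd F Fr a : Set Fr)) ∧
    ∀ (Q : LieSupAlg.{u, max u v} F) (f : ∀ a : ZMod 2, X a → Q.carrier),
      (∀ (a : ZMod 2) (x : X a), f a x ∈ grd F Q.carrier a) →
      ∃! h : Fr →ₗ[F] Q.carrier,
        IsHom F h ∧ ∀ (a : ZMod 2) (x : X a), h (x : Fr) = f a x

/-- `F' ∩ R`, for a free presentation with kernel `R`. -/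
abbrev schurA (F : Type u) [Field F] (Fr : Type v) [AddCommGroup Fr] [Module F Fr]
    [LieSuper F Fr] (R : Submodule F Fr) : Submodule F Fr :=
  derived F Fr ⊓ R

/-- The Schur multiplier `M(L) = (F' ∩ R)/[R,F]` attached to a free presentation
`0 → R → F → L → 0`. -/
abbrev SchurMul (F : Type u) [Field F] (Fr : Type v) [AddCommGroup Fr] [Module F Fr]
    [LieSuper F Fr] (R : Submodule F Fr) :=
  ↥(schurA F Fr R) ⧸ (Submodule.comap (schurA F Fr R).subtype (bracketSpan F R ⊤))

/-- `L` is (isomorphic to) the special Heisenberg Lie superalgebra `H(m,n)` with even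
center: basis `x₁,…,x_{2m}, z` (even), `y₁,…,y_n` (odd), with `[xᵢ, x_{m+i}] = z`,
`[y_j, y_j] = z` and `z` central. -/
def IsHeisE (F : Type u) [Field F] (m n : ℕ) (L : Type v) [AddCommGroup L] [Module F L]
    [LieSuper F L] : Prop :=
  ∃ (x : Fin (2 * m) → L) (y : Fin n → L) (z : L),
    (∀ i, x i ∈ grd F L 0) ∧ z ∈ grd F L 0 ∧ (∀ j, y j ∈ grd F L 1) ∧
    LinearIndependent F (Sum.elim x (Sum.elim y (fun _ : Unit => z))) ∧
    Submodule.span F (Set.range (Sum.elim x (Sum.elim y (fun _ : Unit => z)))) = ⊤ ∧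
    (∀ i j : Fin (2 * m), sbr F (x i) (x j) =
      if (j : ℕ) = (i : ℕ) + m then z else if (i : ℕ) = (j : ℕ) + m then -z else 0) ∧
    (∀ (i : Fin (2 * m)) (j : Fin n), sbr F (x i) (y j) = 0) ∧
    (∀ (i : Fin (2 * m)) (j : Fin n), sbr F (y j) (x i) = 0) ∧
    (∀ i j : Fin n, sbr F (y i) (y j) = if i = j then z else 0) ∧
    (∀ w : L, sbr F z w = 0) ∧ (∀ w : L, sbr F w z = 0)

/-- `L` is (isomorphic to) the Heisenberg Lie superalgebra `H_m` with odd center: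
basis `x₁,…,x_m` (even), `y₁,…,y_m, z` (odd), with `[x_j, y_j] = z` and `z` central. -/
def IsHeisO (F : Type u) [Field F] (m : ℕ) (L : Type v) [AddCommGroup L] [Module F L]
    [LieSuper F L] : Prop :=
  ∃ (x : Fin m → L) (y : Fin m → L) (z : L),
    (∀ i, x i ∈ grd F L 0) ∧ (∀ j, y j ∈ grd F L 1) ∧ z ∈ grd F L 1 ∧
    LinearIndependent F (Sum.elim x (Sum.elim y (fun _ : Unit => z))) ∧
    Submodule.span F (Set.range (Sum.elim x (Sum.elim y (fun _ : Unit => z)))) = ⊤ ∧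
    (∀ i j : Fin m, sbr F (x i) (x j) = 0) ∧
    (∀ i j : Fin m, sbr F (x i) (y j) = if i = j then z else 0) ∧
    (∀ i j : Fin m, sbr F (y j) (x i) = if i = j then -z else 0) ∧
    (∀ i j : Fin m, sbr F (y i) (y j) = 0) ∧
    (∀ w : L, sbr F z w = 0) ∧ (∀ w : L, sbr F w z = 0)

/-- `A` is (isomorphic to) the abelian Lie superalgebra `A(r | s)` of
superdimension `(r | s)`. -/
def IsAbelSuper (F : Type u) [Field F] (r s : ℕ) (A : Type v) [AddCommGroup A]
    [Module F A] [LieSuper F A] : Prop :=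
  (∀ x y : A, sbr F x y = 0) ∧ Module.Finite F A ∧
  Module.finrank F ↥(grd F A 0) = r ∧ Module.finrank F ↥(grd F A 1) = s

/-- The direct sum (product) of two Lie superalgebras. -/
instance prodLieSuper (F : Type u) [Field F] (A : Type v) (B : Type w)
    [AddCommGroup A] [Module F A] [LieSuper F A]
    [AddCommGroup B] [Module F B] [LieSuper F B] : LieSuper F (A × B) where
  gr a := (grd F A a).prod (grd F B a)
  isCompl_gr := by
    have hA : IsCompl (grd F A 0) (grd F A 1) := LieSuper.isCompl_gr
    have hB : IsCompl (grd F B 0) (grd F B 1) := LieSuper.isCompl_gr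
    constructor
    · rw [disjoint_iff, eq_bot_iff]
      rintro ⟨a, b⟩ h
      rw [Submodule.mem_inf] at h
      obtain ⟨h0, h1⟩ := h
      rw [Submodule.mem_prod] at h0 h1
      have ha : a = 0 := by
        have := hA.disjoint.le_bot (Submodule.mem_inf.mpr ⟨h0.1, h1.1⟩)
        simpa using this
      have hb : b = 0 := by
        have := hB.disjoint.le_bot (Submodule.mem_inf.mpr ⟨h0.2, h1.2⟩)
        simpa using this
      simp [ha, hb, Prod.ext_iff]
    · rw [codisjoint_iff, eq_top_iff]
      rintro ⟨a, b⟩ -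
      have ha' : a ∈ grd F A 0 ⊔ grd F A 1 := by
        rw [hA.codisjoint.eq_top]; trivial
      have hb' : b ∈ grd F B 0 ⊔ grd F B 1 := by
        rw [hB.codisjoint.eq_top]; trivial
      obtain ⟨a0, ha0, a1, ha1, rfl⟩ := Submodule.mem_sup.mp ha'
      obtain ⟨b0, hb0, b1, hb1, rfl⟩ := Submodule.mem_sup.mp hb'
      refine Submodule.mem_sup.mpr ⟨(a0, b0), ?_, (a1, b1), ?_, ?_⟩
      · exact Submodule.mem_prod.mpr ⟨ha0, hb0⟩
      · exact Submodule.mem_prod.mpr ⟨ha1, hb1⟩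
      · rfl
  br x y := (sbr F x.1 y.1, sbr F x.2 y.2)
  br_add_left := by
    intro x y z
    simp only [Prod.fst_add, Prod.snd_add, sbr, LieSuper.br_add_left]
    rfl
  br_add_right := by
    intro x y z
    simp only [Prod.fst_add, Prod.snd_add, sbr, LieSuper.br_add_right]
    rfl
  br_smul_left := by
    intro c x y
    simp only [Prod.smul_fst, Prod.smul_snd, sbr, LieSuper.br_smul_left]
    rfl
  br_smul_right := by
    intro c x y
    simp only [Prod.smul_fst, Prod.smul_snd, sbr, LieSuper.br_smul_right]
    rfl
  br_gr := by
    intro a b x hx y hy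
    rw [Submodule.mem_prod] at hx hy ⊢
    exact ⟨LieSuper.br_gr a b x.1 hx.1 y.1 hy.1, LieSuper.br_gr a b x.2 hx.2 y.2 hy.2⟩
  br_skew := by
    intro a b x hx y hy
    rw [Submodule.mem_prod] at hx hy
    have h1 := LieSuper.br_skew (F := F) a b x.1 hx.1 y.1 hy.1
    have h2 := LieSuper.br_skew (F := F) a b x.2 hx.2 y.2 hy.2
    simp only [sbr]
    rw [Prod.ext_iff]
    exact ⟨h1, h2⟩
  br_jacobi := by
    intro a b c x hx y hy z hz
    rw [Submodule.mem_prod] at hx hy hz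
    have h1 := LieSuper.br_jacobi (F := F) a b c x.1 hx.1 y.1 hy.1 z.1 hz.1
    have h2 := LieSuper.br_jacobi (F := F) a b c x.2 hx.2 y.2 hy.2 z.2 hz.2
    simp only [sbr]
    rw [Prod.ext_iff]
    exact ⟨h1, h2⟩

theorem exists_dec (F : Type u) [Field F] {L : Type v} [AddCommGroup L] [Module F L]
    [LieSuper F L] (x : L) : ∃ x0 ∈ grd F L 0, ∃ x1 ∈ grd F L 1, x = x0 + x1 := by
  have hA : IsCompl (grd F L 0) (grd F L 1) := LieSuper.isCompl_gr
  have h : x ∈ grd F L 0 ⊔ grd F L 1 := by rw [hA.codisjoint.eq_top]; trivial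
  obtain ⟨a, ha, b, hb, h⟩ := Submodule.mem_sup.mp h
  exact ⟨a, ha, b, hb, h.symm⟩

theorem dec_zero (F : Type u) [Field F] {L : Type v} [AddCommGroup L] [Module F L]
    [LieSuper F L] {x : L} (h0 : x ∈ grd F L 0) (h1 : x ∈ grd F L 1) : x = 0 := by
  have hA : IsCompl (grd F L 0) (grd F L 1) := LieSuper.isCompl_gr
  have := hA.disjoint.le_bot (Submodule.mem_inf.mpr ⟨h0, h1⟩)
  simpa using this

theorem dec_unique (F : Type u) [Field F] {L : Type v} [AddCommGroup L] [Module F L]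
    [LieSuper F L] {a b c d : L} (ha : a ∈ grd F L 0) (hb : b ∈ grd F L 1)
    (hc : c ∈ grd F L 0) (hd : d ∈ grd F L 1) (h : a + b = c + d) : a = c ∧ b = d := by
  have e : a - c = d - b := by
    rw [sub_eq_sub_iff_add_eq_add, h, add_comm]
  have z := dec_zero F (sub_mem ha hc) (by rw [e]; exact sub_mem hd hb)
  have z2 : d - b = 0 := by rw [← e]; exact z
  exact ⟨sub_eq_zero.mp z, (sub_eq_zero.mp z2).symm⟩

/-- Product of a family of Lie superalgebras. -/
@[reducible] def piLieSuper (F : Type u) [Field F] {ι : Type v} (A : ι → Type w)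
    [∀ i, AddCommGroup (A i)] [∀ i, Module F (A i)] [∀ i, LieSuper F (A i)] :
    LieSuper F (∀ i, A i) where
  gr a := Submodule.pi Set.univ (fun i => grd F (A i) a)
  isCompl_gr := by
    constructor
    · rw [disjoint_iff, eq_bot_iff]
      intro x h
      rw [Submodule.mem_inf, Submodule.mem_pi, Submodule.mem_pi] at h
      rw [Submodule.mem_bot]
      funext i
      exact dec_zero F (h.1 i trivial) (h.2 i trivial)
    · rw [codisjoint_iff, eq_top_iff]
      intro x _
      choose x0 h0 x1 h1 h using fun i => exists_dec F (x i)
      exact Submodule.mem_sup.mpr ⟨x0, fun i _ => h0 i, x1, fun i _ => h1 i,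
        funext fun i => (h i).symm⟩
  br x y := fun i => sbr F (x i) (y i)
  br_add_left x y z := funext fun i => LieSuper.br_add_left _ _ _
  br_add_right x y z := funext fun i => LieSuper.br_add_right _ _ _
  br_smul_left c x y := funext fun i => LieSuper.br_smul_left _ _ _
  br_smul_right c x y := funext fun i => LieSuper.br_smul_right _ _ _
  br_gr a b x hx y hy := fun i _ => LieSuper.br_gr a b _ (hx i trivial) _ (hy i trivial)
  br_skew a b x hx y hy := funext fun i =>
    LieSuper.br_skew a b _ (hx i trivial) _ (hy i trivial)
  br_jacobi a b c x hx y hy z hz := funext fun i =>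
    LieSuper.br_jacobi a b c _ (hx i trivial) _ (hy i trivial) _ (hz i trivial)

/-- Graded subalgebras. -/
structure IsGSub (F : Type u) [Field F] {L : Type v} [AddCommGroup L] [Module F L]
    [LieSuper F L] (S : Submodule F L) : Prop where
  br : ∀ x ∈ S, ∀ y ∈ S, sbr F x y ∈ S
  dec : ∀ x ∈ S, ∃ x0 ∈ S ⊓ grd F L 0, ∃ x1 ∈ S ⊓ grd F L 1, x = x0 + x1

/-- A graded subalgebra is a Lie superalgebra. -/
@[reducible] def subLieSuper (F : Type u) [Field F] {L : Type v} [AddCommGroup L] [Module F L]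
    [LieSuper F L] (S : Submodule F L) (hS : IsGSub F S) : LieSuper F S where
  gr a := (grd F L a).comap S.subtype
  isCompl_gr := by
    constructor
    · rw [disjoint_iff, eq_bot_iff]
      intro x h
      rw [Submodule.mem_inf] at h
      rw [Submodule.mem_bot]
      exact Subtype.ext (dec_zero F h.1 h.2)
    · rw [codisjoint_iff, eq_top_iff]
      rintro ⟨x, hx⟩ _
      obtain ⟨x0, h0, x1, h1, h⟩ := hS.dec x hx
      exact Submodule.mem_sup.mpr ⟨⟨x0, h0.1⟩, h0.2, ⟨x1, h1.1⟩, h1.2, Subtype.ext h.symm⟩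
  br x y := ⟨sbr F (x : L) (y : L), hS.br _ x.2 _ y.2⟩
  br_add_left x y z := Subtype.ext (LieSuper.br_add_left _ _ _)
  br_add_right x y z := Subtype.ext (LieSuper.br_add_right _ _ _)
  br_smul_left c x y := Subtype.ext (LieSuper.br_smul_left _ _ _)
  br_smul_right c x y := Subtype.ext (LieSuper.br_smul_right _ _ _)
  br_gr a b x hx y hy := LieSuper.br_gr (F := F) a b (x : L) hx (y : L) hy
  br_skew a b x hx y hy := Subtype.ext (LieSuper.br_skew (F := F) a b (x : L) hx (y : L) hy)
  br_jacobi a b c x hx y hy z hz := Subtype.ext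
    (LieSuper.br_jacobi (F := F) a b c (x : L) hx (y : L) hy (z : L) hz)

theorem IsHom.range_gsub {F : Type u} [Field F] {L : Type v} {M : Type w}
    [AddCommGroup L] [Module F L] [LieSuper F L]
    [AddCommGroup M] [Module F M] [LieSuper F M] {f : L →ₗ[F] M} (hf : IsHom F f) :
    IsGSub F (LinearMap.range f) := by
  constructor
  · rintro _ ⟨x, rfl⟩ _ ⟨y, rfl⟩
    exact ⟨sbr F x y, hf.2 x y⟩
  · rintro _ ⟨x, rfl⟩
    obtain ⟨x0, h0, x1, h1, rfl⟩ := exists_dec F x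
    exact ⟨f x0, ⟨⟨x0, rfl⟩, hf.1 0 _ h0⟩, f x1, ⟨⟨x1, rfl⟩, hf.1 1 _ h1⟩, map_add _ _ _⟩

theorem IsHom.comap_gsub {F : Type u} [Field F] {L : Type v} {M : Type w}
    [AddCommGroup L] [Module F L] [LieSuper F L]
    [AddCommGroup M] [Module F M] [LieSuper F M] {f : L →ₗ[F] M} (hf : IsHom F f)
    {S : Submodule F M} (hS : IsGSub F S) : IsGSub F (S.comap f) := by
  constructor
  · intro x hx y hy
    rw [Submodule.mem_comap, hf.2]
    exact hS.br _ hx _ hy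
  · intro x hx
    obtain ⟨x0, h0, x1, h1, rfl⟩ := exists_dec F x
    obtain ⟨s0, g0, s1, g1, h⟩ := hS.dec _ hx
    rw [map_add] at h
    obtain ⟨e0, e1⟩ := dec_unique F (hf.1 0 _ h0) (hf.1 1 _ h1) g0.2 g1.2 h
    refine ⟨x0, ⟨?_, h0⟩, x1, ⟨?_, h1⟩, rfl⟩
    · change f x0 ∈ S
      rw [e0]; exact g0.1
    · change f x1 ∈ S
      rw [e1]; exact g1.1

theorem quotCapable_aux (F : Type u) [Field F]
    (L : Type v) [AddCommGroup L] [Module F L] [LieSuper F L]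
    {J : Type v} (N : J → Submodule F L)
    (hCap : ∀ i : J, QuotCapable F L (N i)) :
    QuotCapable F L (⨅ i : J, N i) := by
  classical
  choose Q p hp hps hpk H f hf hfs hfk using hCap
  letI iQ : LieSuper F (∀ i, (Q i).carrier) := piLieSuper F _
  letI iH : LieSuper F (∀ i, (H i).carrier) := piLieSuper F _
  let P : L →ₗ[F] (∀ i, (Q i).carrier) := LinearMap.pi p
  let Φ : (∀ i, (H i).carrier) →ₗ[F] (∀ i, (Q i).carrier) :=
    LinearMap.pi fun i => (f i).comp (LinearMap.proj i)
  have hP : IsHom F P :=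
    ⟨fun a x hx i _ => (hp i).1 a x hx, fun x y => funext fun i => (hp i).2 x y⟩
  have hΦ : IsHom F Φ :=
    ⟨fun a x hx i _ => (hf i).1 a _ (hx i trivial), fun x y => funext fun i => (hf i).2 _ _⟩
  have gQ := hP.range_gsub
  have gH := hΦ.comap_gsub gQ
  letI sQ : LieSuper F (LinearMap.range P) := subLieSuper F _ gQ
  letI sH : LieSuper F ((LinearMap.range P).comap Φ) := subLieSuper F _ gH
  refine ⟨⟨LinearMap.range P⟩, P.rangeRestrict, ⟨fun a x hx => hP.1 a x hx,
    fun x y => Subtype.ext (hP.2 x y)⟩, P.surjective_rangeRestrict, ?_,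
    ⟨⟨(LinearMap.range P).comap Φ⟩, Φ.restrict (fun x hx => hx), ⟨fun a x hx => hΦ.1 a _ hx,
    fun x y => Subtype.ext (hΦ.2 _ _)⟩, ?_, ?_⟩⟩
  · rw [LinearMap.ker_rangeRestrict]
    simp only [P, LinearMap.ker_pi, hpk]
  · rintro ⟨_, l, rfl⟩
    choose h hh using fun i => hfs i (p i l)
    have e : Φ h = P l := funext hh
    exact ⟨⟨h, l, e.symm⟩, Subtype.ext e⟩
  · ext ⟨x, hx⟩
    have key : (⟨x, hx⟩ : (LinearMap.range P).comap Φ) ∈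
        LinearMap.ker (Φ.restrict (p := (LinearMap.range P).comap Φ)
          (q := LinearMap.range P) (fun x hx => hx)) ↔ ∀ i, f i (x i) = 0 := by
      rw [LinearMap.mem_ker, Subtype.ext_iff]
      exact funext_iff
    refine key.trans ⟨fun h y => Subtype.ext (funext fun i => ?_), fun h i => ?_⟩
    · have : x i ∈ centerS F (H i).carrier := by rw [← hfk]; exact h i
      exact this _
    · have : x i ∈ centerS F (H i).carrier := by
        intro y
        obtain ⟨l, hl⟩ := hps i (f i y)
        choose k hk using fun j => hfs j (p j l)
        have hk' : Φ (Function.update k i y) = P l := by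
          funext j
          by_cases hj : j = i
          · subst hj
            change f j (Function.update k j y j) = p j l
            rw [Function.update_self, hl]
          · change f j (Function.update k i y j) = p j l
            rw [Function.update_of_ne hj, hk]
        have h2 := congrFun (congrArg Subtype.val (h ⟨Function.update k i y, l, hk'.symm⟩)) i
        change sbr F (x i) (Function.update k i y i) = 0 at h2
        rwa [Function.update_self] at h2
      rw [← hfk] at this
      exact this

/-- if `{N_i}_{i ∈ J}` is a family of graded ideals of a Lie
superalgebra `L` such that each quotient `L/N_i` is capable, then
`L/⋂_{i ∈ J} N_i` is capable. -/
theorem quotient_inf_capable (F : Type u) [Field F] (hchar2 : (2 : F) ≠ 0)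
    (hchar3 : (3 : F) ≠ 0)
    (L : Type v) [AddCommGroup L] [Module F L] [LieSuper F L]
    {J : Type w} (N : J → Submodule F L)
    (hIdeal : ∀ i : J, IsGIdeal F (N i))
    (hCap : ∀ i : J, QuotCapable F L (N i)) :
    QuotCapable F L (⨅ i : J, N i) := by
  have h := quotCapable_aux F L (fun S : Set.range N => (S : Submodule F L))
    (by rintro ⟨_, i, rfl⟩; exact hCap i)
  rwa [← sInf_eq_iInf', sInf_range] at h

end SuperLie
end

section
/- For any Lie superalgebra L over a field F (char F ≠ 2,3), the epicenter satisfies Z*(L) = ⋂ { φ(Z(M)) : φ: M → L is a surjective homomorphism of Lie superalgebras with ker(φ) ⊆ Z(M) }. -/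
/-!
Common definitions: Lie superalgebras over a field `F` (char ≠ 2,3 where needed),
graded ideals, centers, capability, epicenter, non-abelian tensor and exterior
products (characterized by generators-and-relations universal properties),
free Lie superalgebras, Schur multipliers, Heisenberg Lie superalgebras, etc.
-/

namespace SuperLie

open Submodule Function Module

universe u v w

section Helpers

variable {F : Type u} [Field F] {L : Type v} [AddCommGroup L] [Module F L] [LieSuper F L]

lemma sbr_add_left (x y z : L) : sbr F (x + y) z = sbr F x z + sbr F y z :=
  LieSuper.br_add_left x y z

lemma sbr_add_right (x y z : L) : sbr F x (y + z) = sbr F x y + sbr F x z :=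
  LieSuper.br_add_right x y z

lemma sbr_smul_left (c : F) (x y : L) : sbr F (c • x) y = c • sbr F x y :=
  LieSuper.br_smul_left c x y

lemma sbr_smul_right (c : F) (x y : L) : sbr F x (c • y) = c • sbr F x y :=
  LieSuper.br_smul_right c x y

lemma sbr_zero_right (x : L) : sbr F x 0 = 0 := by
  have h := sbr_smul_right (0 : F) x (0 : L)
  simpa using h

lemma sbr_zero_left (x : L) : sbr F 0 x = 0 := by
  have h := sbr_smul_left (0 : F) (0 : L) x
  simpa using h

variable (F) in
lemma exists_decomp (x : L) : ∃ x0 ∈ grd F L 0, ∃ x1 ∈ grd F L 1, x = x0 + x1 := by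
  have h : IsCompl (grd F L 0) (grd F L 1) := LieSuper.isCompl_gr
  have hx : x ∈ grd F L 0 ⊔ grd F L 1 := by rw [h.codisjoint.eq_top]; trivial
  obtain ⟨a, ha, b, hb, hab⟩ := Submodule.mem_sup.mp hx
  exact ⟨a, ha, b, hb, hab.symm⟩

lemma grd_zero_of_mem {x : L} (h0 : x ∈ grd F L 0) (h1 : x ∈ grd F L 1) : x = 0 := by
  have h : IsCompl (grd F L 0) (grd F L 1) := LieSuper.isCompl_gr
  simpa using h.disjoint.le_bot (Submodule.mem_inf.mpr ⟨h0, h1⟩)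

lemma grd_add_eq_zero {x y : L} (h0 : x ∈ grd F L 0) (h1 : y ∈ grd F L 1) (h : x + y = 0) :
    x = 0 ∧ y = 0 := by
  have hx : x = -y := eq_neg_of_add_eq_zero_left h
  have : x = 0 := grd_zero_of_mem h0 (by rw [hx]; exact neg_mem h1)
  subst this
  simpa using h

lemma zmod2_cases (a : ZMod 2) : a = 0 ∨ a = 1 := by
  revert a; decide

lemma mem_center {z : L} : z ∈ centerS F L ↔ ∀ x : L, sbr F z x = 0 := Iff.rfl

/-- homogeneous components of central elements are central -/
lemma center_graded {x0 x1 : L} (h0 : x0 ∈ grd F L 0) (h1 : x1 ∈ grd F L 1)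
    (h : x0 + x1 ∈ centerS F L) : x0 ∈ centerS F L ∧ x1 ∈ centerS F L := by
  have key : ∀ a : ZMod 2, ∀ y ∈ grd F L a, sbr F x0 y = 0 ∧ sbr F x1 y = 0 := by
    intro a y hy
    have e := mem_center.mp h y
    rw [sbr_add_left] at e
    have m0 : sbr F x0 y ∈ grd F L (0 + a) := LieSuper.br_gr 0 a x0 h0 y hy
    have m1 : sbr F x1 y ∈ grd F L (1 + a) := LieSuper.br_gr 1 a x1 h1 y hy
    rcases zmod2_cases a with rfl | rfl
    · exact grd_add_eq_zero (by simpa using m0) (by simpa using m1) e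
    · rw [add_comm] at e
      have e11 : (1 : ZMod 2) + 1 = 0 := by decide
      rw [e11] at m1
      exact (grd_add_eq_zero m1 (by simpa using m0) e).symm
  constructor
  · intro y
    obtain ⟨y0, hy0, y1, hy1, rfl⟩ := exists_decomp F y
    rw [sbr_add_right, (key 0 y0 hy0).1, (key 1 y1 hy1).1, add_zero]
  · intro y
    obtain ⟨y0, hy0, y1, hy1, rfl⟩ := exists_decomp F y
    rw [sbr_add_right, (key 0 y0 hy0).2, (key 1 y1 hy1).2, add_zero]

lemma center_right {z : L} (hz : z ∈ centerS F L) (x : L) : sbr F x z = 0 := by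
  obtain ⟨z0, hz0, z1, hz1, rfl⟩ := exists_decomp F z
  obtain ⟨c0, c1⟩ := center_graded hz0 hz1 hz
  obtain ⟨x0, hx0, x1, hx1, rfl⟩ := exists_decomp F x
  have aux : ∀ a b : ZMod 2, ∀ x ∈ grd F L a, ∀ z ∈ grd F L b, z ∈ centerS F L →
      sbr F x z = 0 := by
    intro a b x hx z hz hc
    have h : sbr F x z = -(sg F a b) • sbr F z x := LieSuper.br_skew a b x hx z hz
    rw [h, mem_center.mp hc x, smul_zero]
  simp only [sbr_add_left, sbr_add_right, aux 0 0 x0 hx0 z0 hz0 c0, aux 0 1 x0 hx0 z1 hz1 c1,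
    aux 1 0 x1 hx1 z0 hz0 c0, aux 1 1 x1 hx1 z1 hz1 c1, add_zero]

lemma center_isGIdeal : IsGIdeal F (centerS F L) := by
  refine ⟨?_, ?_, ?_⟩
  · intro x hx y
    rw [mem_center.mp hx y]; exact zero_mem _
  · intro y x hx
    rw [center_right hx y]; exact zero_mem _
  · intro x hx
    obtain ⟨x0, h0, x1, h1, rfl⟩ := exists_decomp F x
    obtain ⟨c0, c1⟩ := center_graded h0 h1 hx
    exact ⟨x0, ⟨c0, h0⟩, x1, ⟨c1, h1⟩, rfl⟩

/-- bracket on the quotient -/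
noncomputable def qbr (F : Type u) [Field F] {L : Type v} [AddCommGroup L] [Module F L]
    [LieSuper F L] (I : Submodule F L) (x y : L ⧸ I) : L ⧸ I :=
  I.mkQ (sbr F (Quotient.out x) (Quotient.out y))

lemma qbr_mk {I : Submodule F L} (hI : IsGIdeal F I) (x y : L) :
    qbr F I (I.mkQ x) (I.mkQ y) = I.mkQ (sbr F x y) := by
  have hx : I.mkQ (Quotient.out (I.mkQ x)) = I.mkQ x := Quotient.out_eq _
  have hy : I.mkQ (Quotient.out (I.mkQ y)) = I.mkQ y := Quotient.out_eq _
  unfold qbr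
  generalize Quotient.out (I.mkQ x) = x' at *
  generalize Quotient.out (I.mkQ y) = y' at *
  rw [← sub_eq_zero, ← map_sub, Submodule.mkQ_apply, Submodule.Quotient.mk_eq_zero] at hx hy
  obtain ⟨i, rfl⟩ : ∃ i, x' = x + i := ⟨x' - x, by abel⟩
  obtain ⟨j, rfl⟩ : ∃ j, y' = y + j := ⟨y' - y, by abel⟩
  rw [add_sub_cancel_left] at hx hy
  rw [← sub_eq_zero, ← map_sub, Submodule.mkQ_apply, Submodule.Quotient.mk_eq_zero]
  have : sbr F (x + i) (y + j) - sbr F x y = sbr F i (y + j) + sbr F x j := by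
    rw [sbr_add_left, sbr_add_right x]; abel
  rw [this]
  exact add_mem (hI.1 i hx _) (hI.2.1 x j hy)

/-- the quotient Lie superalgebra -/
@[reducible] noncomputable def quotLS (I : Submodule F L) (hI : IsGIdeal F I) :
    LieSuper F (L ⧸ I) where
  gr a := (grd F L a).map I.mkQ
  isCompl_gr := by
    constructor
    · rw [disjoint_iff, eq_bot_iff]
      rintro q ⟨⟨x, hx, rfl⟩, ⟨y, hy, hxy⟩⟩
      have h : x - y ∈ I := by
        rw [← Submodule.Quotient.mk_eq_zero, ← Submodule.mkQ_apply, map_sub, hxy, sub_self]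
      obtain ⟨i0, ⟨hi0, g0⟩, i1, ⟨hi1, g1⟩, e⟩ := hI.2.2 _ h
      have e' : (x - i0) + -(y + i1) = 0 := by
        have : (x - i0) + -(y + i1) = (x - y) - (i0 + i1) := by abel
        rw [this, e, sub_self]
      have := (grd_add_eq_zero (sub_mem hx g0) (neg_mem (add_mem hy g1)) e').1
      rw [sub_eq_zero] at this
      subst this
      simpa using hi0
    · rw [codisjoint_iff, eq_top_iff]
      intro q _
      obtain ⟨x, rfl⟩ := I.mkQ_surjective q
      obtain ⟨x0, h0, x1, h1, rfl⟩ := exists_decomp F x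
      rw [map_add]
      exact Submodule.add_mem_sup (Submodule.mem_map_of_mem h0) (Submodule.mem_map_of_mem h1)
  br := qbr F I
  br_add_left := by
    intro x y z
    obtain ⟨x, rfl⟩ := I.mkQ_surjective x
    obtain ⟨y, rfl⟩ := I.mkQ_surjective y
    obtain ⟨z, rfl⟩ := I.mkQ_surjective z
    simp only [← map_add, qbr_mk hI, sbr_add_left]
  br_add_right := by
    intro x y z
    obtain ⟨x, rfl⟩ := I.mkQ_surjective x
    obtain ⟨y, rfl⟩ := I.mkQ_surjective y
    obtain ⟨z, rfl⟩ := I.mkQ_surjective z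
    simp only [← map_add, qbr_mk hI, sbr_add_right]
  br_smul_left := by
    intro c x y
    obtain ⟨x, rfl⟩ := I.mkQ_surjective x
    obtain ⟨y, rfl⟩ := I.mkQ_surjective y
    simp only [← map_smul, qbr_mk hI, sbr_smul_left]
  br_smul_right := by
    intro c x y
    obtain ⟨x, rfl⟩ := I.mkQ_surjective x
    obtain ⟨y, rfl⟩ := I.mkQ_surjective y
    simp only [← map_smul, qbr_mk hI, sbr_smul_right]
  br_gr := by
    rintro a b _ ⟨x, hx, rfl⟩ _ ⟨y, hy, rfl⟩
    rw [qbr_mk hI]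
    exact Submodule.mem_map_of_mem (LieSuper.br_gr a b x hx y hy)
  br_skew := by
    rintro a b _ ⟨x, hx, rfl⟩ _ ⟨y, hy, rfl⟩
    rw [qbr_mk hI, qbr_mk hI, ← map_smul]
    exact congrArg I.mkQ (LieSuper.br_skew a b x hx y hy)
  br_jacobi := by
    rintro a b c _ ⟨x, hx, rfl⟩ _ ⟨y, hy, rfl⟩ _ ⟨z, hz, rfl⟩
    simp only [qbr_mk hI, ← map_smul, ← map_add]
    exact (congrArg I.mkQ (LieSuper.br_jacobi a b c x hx y hy z hz)).trans (map_zero _)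

/-- graded subalgebras are Lie superalgebras -/
@[reducible] def subLS (S : Submodule F L) (hb : ∀ x ∈ S, ∀ y ∈ S, sbr F x y ∈ S)
    (hg : ∀ x ∈ S, ∃ x0 ∈ S ⊓ grd F L 0, ∃ x1 ∈ S ⊓ grd F L 1, x = x0 + x1) :
    LieSuper F S where
  gr a := (grd F L a).comap S.subtype
  isCompl_gr := by
    constructor
    · rw [disjoint_iff, eq_bot_iff]
      rintro x ⟨h0, h1⟩
      exact (Submodule.mem_bot F).mpr (Subtype.ext (grd_zero_of_mem h0 h1))
    · rw [codisjoint_iff, eq_top_iff]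
      rintro ⟨x, hx⟩ _
      obtain ⟨x0, ⟨s0, h0⟩, x1, ⟨s1, h1⟩, rfl⟩ := hg x hx
      exact Submodule.mem_sup.mpr ⟨⟨x0, s0⟩, h0, ⟨x1, s1⟩, h1, rfl⟩
  br x y := ⟨sbr F x.1 y.1, hb _ x.2 _ y.2⟩
  br_add_left x y z := Subtype.ext (sbr_add_left x.1 y.1 z.1)
  br_add_right x y z := Subtype.ext (sbr_add_right x.1 y.1 z.1)
  br_smul_left c x y := Subtype.ext (sbr_smul_left c x.1 y.1)
  br_smul_right c x y := Subtype.ext (sbr_smul_right c x.1 y.1)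
  br_gr a b x hx y hy := LieSuper.br_gr (F := F) a b x.1 hx y.1 hy
  br_skew a b x hx y hy := Subtype.ext (LieSuper.br_skew (F := F) a b x.1 hx y.1 hy)
  br_jacobi a b c x hx y hy z hz :=
    Subtype.ext (LieSuper.br_jacobi (F := F) a b c x.1 hx y.1 hy z.1 hz)

lemma exists_homog_preimage {M : Type w} [AddCommGroup M] [Module F M] [LieSuper F M]
    {φ : M →ₗ[F] L} (hφ : IsHom F φ) (hs : Surjective φ) (a : ZMod 2) (x : L)
    (hx : x ∈ grd F L a) : ∃ m ∈ grd F M a, φ m = x := by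
  obtain ⟨m, rfl⟩ := hs x
  obtain ⟨m0, h0, m1, h1, rfl⟩ := exists_decomp F m
  have g0 := hφ.1 0 m0 h0
  have g1 := hφ.1 1 m1 h1
  rw [map_add] at hx
  rcases zmod2_cases a with rfl | rfl
  · refine ⟨m0, h0, ?_⟩
    have : φ m1 = 0 := grd_zero_of_mem (by simpa using sub_mem hx g0) g1
    rw [map_add, this, add_zero]
  · refine ⟨m1, h1, ?_⟩
    have : φ m0 = 0 := grd_zero_of_mem g0 (by simpa using sub_mem hx g1)
    rw [map_add, this, zero_add]

lemma map_center_isGIdeal {M : Type w} [AddCommGroup M] [Module F M] [LieSuper F M]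
    {φ : M →ₗ[F] L} (hφ : IsHom F φ) (hs : Surjective φ) :
    IsGIdeal F ((centerS F M).map φ) := by
  refine ⟨?_, ?_, ?_⟩
  · rintro _ ⟨z, hz, rfl⟩ y
    obtain ⟨m, rfl⟩ := hs y
    rw [← hφ.2, mem_center.mp hz, map_zero]; exact zero_mem _
  · rintro y _ ⟨z, hz, rfl⟩
    obtain ⟨m, rfl⟩ := hs y
    rw [← hφ.2, center_right hz, map_zero]; exact zero_mem _
  · rintro _ ⟨z, hz, rfl⟩
    obtain ⟨x0, h0, x1, h1, rfl⟩ := exists_decomp F z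
    obtain ⟨c0, c1⟩ := center_graded h0 h1 hz
    exact ⟨φ x0, ⟨Submodule.mem_map_of_mem c0, hφ.1 0 x0 h0⟩, φ x1,
      ⟨Submodule.mem_map_of_mem c1, hφ.1 1 x1 h1⟩, map_add _ _ _⟩

lemma map_center_quotCapable (M : LieSupAlg.{u, max u v} F) (φ : M.carrier →ₗ[F] L)
    (hφ : IsHom F φ) (hs : Surjective φ) (hk : LinearMap.ker φ ≤ centerS F M.carrier) :
    QuotCapable F L ((centerS F M.carrier).map φ) := by
  letI : LieSuper F (M.carrier ⧸ centerS F M.carrier) := quotLS _ center_isGIdeal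
  have hmk : IsHom F (centerS F M.carrier).mkQ := by
    refine ⟨fun a x hx => Submodule.mem_map_of_mem hx, fun x y => ?_⟩
    exact (qbr_mk center_isGIdeal x y).symm
  let π : L →ₗ[F] (M.carrier ⧸ centerS F M.carrier) :=
    (Submodule.factor hk) ∘ₗ (φ.quotKerEquivOfSurjective hs).symm.toLinearMap
  have hπ : ∀ m, π (φ m) = (centerS F M.carrier).mkQ m := by
    intro m
    have : (φ.quotKerEquivOfSurjective hs).symm (φ m) = (LinearMap.ker φ).mkQ m := by
      rw [LinearEquiv.symm_apply_eq]; rfl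
    simp only [π, LinearMap.comp_apply, LinearEquiv.coe_coe, this]
    rfl
  refine ⟨⟨M.carrier ⧸ centerS F M.carrier⟩, π, ⟨?_, ?_⟩, ?_, ?_, ?_⟩
  · intro a x hx
    obtain ⟨m, hm, rfl⟩ := exists_homog_preimage hφ hs a x hx
    rw [hπ]
    exact hmk.1 a m hm
  · intro x y
    obtain ⟨x, rfl⟩ := hs x
    obtain ⟨y, rfl⟩ := hs y
    rw [← hφ.2, hπ, hπ, hπ]
    exact hmk.2 x y
  · intro q
    obtain ⟨m, rfl⟩ := (centerS F M.carrier).mkQ_surjective q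
    exact ⟨φ m, hπ m⟩
  · ext x
    obtain ⟨m, rfl⟩ := hs x
    rw [LinearMap.mem_ker, hπ, Submodule.mkQ_apply, Submodule.Quotient.mk_eq_zero]
    constructor
    · exact fun h => Submodule.mem_map_of_mem h
    · rintro ⟨z, hz, e⟩
      have : m - z ∈ LinearMap.ker φ := by rw [LinearMap.mem_ker, map_sub, e, sub_self]
      have := add_mem (hk this) hz
      simpa using this
  · exact ⟨M, (centerS F M.carrier).mkQ, hmk, Submodule.mkQ_surjective _, Submodule.ker_mkQ _⟩

lemma exists_pullback (Z : Submodule F L) (h : QuotCapable F L Z) :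
    ∃ (M : LieSupAlg.{u, max u v} F) (φ : M.carrier →ₗ[F] L),
        IsHom F φ ∧ Surjective φ ∧ LinearMap.ker φ ≤ centerS F M.carrier ∧
          Submodule.map φ (centerS F M.carrier) ≤ Z := by
  obtain ⟨Q, π, hπ, hπs, hπk, H, ψ, hψ, hψs, hψk⟩ := h
  let S : Submodule F (L × H.carrier) :=
    LinearMap.ker (π ∘ₗ LinearMap.fst F L H.carrier - ψ ∘ₗ LinearMap.snd F L H.carrier)
  have hS : ∀ p : L × H.carrier, p ∈ S ↔ π p.1 = ψ p.2 := by
    intro p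
    simp [S, sub_eq_zero]
  have hb : ∀ x ∈ S, ∀ y ∈ S, sbr F x y ∈ S := by
    intro x hx y hy
    rw [hS] at *
    change π (sbr F x.1 y.1) = ψ (sbr F x.2 y.2)
    rw [hπ.2, hψ.2, hx, hy]
  have hg : ∀ x ∈ S, ∃ x0 ∈ S ⊓ grd F (L × H.carrier) 0,
      ∃ x1 ∈ S ⊓ grd F (L × H.carrier) 1, x = x0 + x1 := by
    intro x hx
    obtain ⟨x0, h0, x1, h1, rfl⟩ := exists_decomp F x
    rw [hS] at hx
    have k0 : x0.1 ∈ grd F L 0 ∧ x0.2 ∈ grd F H.carrier 0 := h0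
    have k1 : x1.1 ∈ grd F L 1 ∧ x1.2 ∈ grd F H.carrier 1 := h1
    have e : (π x0.1 - ψ x0.2) + (π x1.1 - ψ x1.2) = 0 := by
      have : (π x0.1 - ψ x0.2) + (π x1.1 - ψ x1.2) = π (x0 + x1).1 - ψ (x0 + x1).2 := by
        simp only [Prod.fst_add, Prod.snd_add, map_add]; abel
      rw [this, hx, sub_self]
    obtain ⟨e0, e1⟩ := grd_add_eq_zero
      (sub_mem (hπ.1 0 _ k0.1) (hψ.1 0 _ k0.2)) (sub_mem (hπ.1 1 _ k1.1) (hψ.1 1 _ k1.2)) e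
    exact ⟨x0, ⟨(hS _).2 (sub_eq_zero.mp e0), h0⟩, x1, ⟨(hS _).2 (sub_eq_zero.mp e1), h1⟩, rfl⟩
  letI : LieSuper F S := subLS S hb hg
  refine ⟨⟨S⟩, LinearMap.fst F L H.carrier ∘ₗ S.subtype, ⟨?_, ?_⟩, ?_, ?_, ?_⟩
  · intro a x hx
    exact hx.1
  · intro x y
    rfl
  · intro l
    obtain ⟨k, hk⟩ := hψs (π l)
    exact ⟨⟨(l, k), (hS _).2 hk.symm⟩, rfl⟩
  · rintro ⟨⟨l, k⟩, hlk⟩ hx y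
    have hl : l = 0 := hx
    subst hl
    have e : π 0 = ψ k := (hS _).1 hlk
    have hk : k ∈ centerS F H.carrier := by
      rw [← hψk, LinearMap.mem_ker, ← e, map_zero]
    apply Subtype.ext
    change (sbr F (0 : L) y.1.1, sbr F k y.1.2) = 0
    rw [sbr_zero_left, mem_center.mp hk]; rfl
  · rintro _ ⟨⟨⟨l, k⟩, hlk⟩, hx, rfl⟩
    change l ∈ Z
    have hk : k ∈ centerS F H.carrier := by
      intro y
      obtain ⟨l', hl'⟩ := hπs (ψ y)
      have := hx ⟨(l', y), (hS _).2 hl'⟩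
      exact congrArg (fun t : S => t.1.2) this
    rw [← hψk, LinearMap.mem_ker] at hk
    rw [← hπk, LinearMap.mem_ker]
    exact ((hS _).1 hlk).trans hk

end Helpers

/-- `Z*(L) = ⋂ {φ(Z(M)) : φ : M → L surjective homomorphism of Lie
superalgebras with ker φ ⊆ Z(M)}`. -/
theorem epicenter_eq_sInf_images_of_centers (F : Type u) [Field F]
    (hchar2 : (2 : F) ≠ 0) (hchar3 : (3 : F) ≠ 0)
    (L : Type v) [AddCommGroup L] [Module F L] [LieSuper F L]
    (Z : Submodule F L) (hZ : IsEpicenter F L Z) :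
    Z = sInf { P : Submodule F L |
      ∃ (M : LieSupAlg.{u, max u v} F) (φ : M.carrier →ₗ[F] L),
        IsHom F φ ∧ Surjective φ ∧ LinearMap.ker φ ≤ centerS F M.carrier ∧
          P = Submodule.map φ (centerS F M.carrier) } := by
  obtain ⟨hI, hQ, hmin⟩ := hZ
  apply le_antisymm
  · refine le_sInf ?_
    rintro _ ⟨M, φ, hφ, hs, hk, rfl⟩
    exact hmin _ (map_center_isGIdeal hφ hs) (map_center_quotCapable M φ hφ hs hk)
  · obtain ⟨M, φ, hφ, hs, hk, hle⟩ := exists_pullback Z hQ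
    refine le_trans (sInf_le ?_) hle
    exact ⟨M, φ, hφ, hs, hk, rfl⟩

end SuperLie
end
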